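/- arXiv:2305.16119 — 3 statements merged into one kernel-verified Lean document; each statement's English description precedes it below -/
import Mathlib

section
/- Suppose D, E ∈ O are nonzero octonions with DE = 0. Then N(D) = N(E) = 0; the left annihilator ann_L(D) = {x ∈ O : xD = 0} and the right annihilator ann_R(D) = {x ∈ O : Dx = 0} are 4-dimensional F_q-subspaces of O on which N vanishes identically; the intersection ann_L(D) ∩ ann_R(D) has dimension 3 if B(D, 1) = 0 and dimension 1 otherwise; and the intersection ann_L(D) ∩ ann_R(E) has dimension 3. -/
/-!  The split octonion algebra `O` over a finite field `F` of order `q`,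
represented as `Fin 8 → F` with coordinates with respect to the basis
`x_1, …, x_8` (index `i : Fin 8` corresponds to `x_{i+1}`). -/

variable {F : Type*}

/-- The split octonion multiplication, determined by the table
`x_1x_5 = x_1`, `x_1x_6 = x_2`, `x_1x_7 = −x_3`, `x_1x_8 = −x_4`, `x_2x_3 = −x_1`,
`x_2x_4 = x_2`, `x_2x_7 = −x_5`, `x_2x_8 = x_6`, `x_3x_2 = x_1`, `x_3x_4 = x_3`,
`x_3x_6 = −x_5`, `x_3x_8 = −x_7` (the sign of `x_3x_8` is forced by `x_8x_3 = x_7` and anti-commutativity of orthogonal imaginary octonions; with it `O` is the split octonion composition algebra), `x_4x_1 = x_1`, `x_4x_4 = x_4`, `x_4x_6 = x_6`,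
`x_4x_7 = x_7`, `x_5x_2 = x_2`, `x_5x_3 = x_3`, `x_5x_5 = x_5`, `x_5x_8 = x_8`,
`x_6x_1 = −x_2`, `x_6x_3 = −x_4`, `x_6x_5 = x_6`, `x_6x_7 = x_8`, `x_7x_1 = x_3`,
`x_7x_2 = −x_4`, `x_7x_5 = x_7`, `x_7x_6 = −x_8`, `x_8x_1 = −x_5`, `x_8x_2 = −x_6`,
`x_8x_3 = x_7`, `x_8x_4 = x_8`, all other products of basis elements being `0`. -/
def octMul [Field F] (a b : Fin 8 → F) : Fin 8 → F :=
  ![a 0 * b 4 - a 1 * b 2 + a 2 * b 1 + a 3 * b 0,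
    a 0 * b 5 + a 1 * b 3 + a 4 * b 1 - a 5 * b 0,
    -(a 0 * b 6) + a 2 * b 3 + a 4 * b 2 + a 6 * b 0,
    -(a 0 * b 7) + a 3 * b 3 - a 5 * b 2 - a 6 * b 1,
    -(a 1 * b 6) - a 2 * b 5 + a 4 * b 4 - a 7 * b 0,
    a 1 * b 7 + a 3 * b 5 + a 5 * b 4 - a 7 * b 1,
    -(a 2 * b 7) + a 3 * b 6 + a 6 * b 4 + a 7 * b 2,
    a 4 * b 7 + a 5 * b 6 - a 6 * b 5 + a 7 * b 3]

/-- The identity `1 = x_4 + x_5` of the octonion algebra. -/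
def octOne [Field F] : Fin 8 → F := ![0, 0, 0, 1, 1, 0, 0, 0]

/-- Octonion conjugation: swaps `x_4, x_5` and negates the other basis vectors. -/
def octConj [Field F] (a : Fin 8 → F) : Fin 8 → F :=
  ![-a 0, -a 1, -a 2, a 4, a 3, -a 5, -a 6, -a 7]

/-- The trace `Tr(Σ λ_i x_i) = λ_4 + λ_5`. -/
def octTr [Field F] (a : Fin 8 → F) : F := a 3 + a 4

/-- The norm `N(Σ λ_i x_i) = λ_1λ_8 + λ_2λ_7 + λ_3λ_6 + λ_4λ_5`. -/
def octN [Field F] (a : Fin 8 → F) : F :=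
  a 0 * a 7 + a 1 * a 6 + a 2 * a 5 + a 3 * a 4

/-- The bilinear form `B(x,y) = N(x+y) − N(x) − N(y)`. -/
def octB [Field F] (a b : Fin 8 → F) : F := octN (a + b) - octN a - octN b

/-- The basis octonion `x_1`. -/
def octX1 [Field F] : Fin 8 → F := ![1, 0, 0, 0, 0, 0, 0, 0]

open scoped Classical

section Octonion

variable [Field F]

/-- Octonion multiplication as a bilinear map. -/
def octMulBilin : (Fin 8 → F) →ₗ[F] (Fin 8 → F) →ₗ[F] (Fin 8 → F) :=
  LinearMap.mk₂ F octMul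
    (fun a b c => by ext i; fin_cases i <;> simp [octMul] <;> ring)
    (fun a b c => by ext i; fin_cases i <;> simp [octMul] <;> ring)
    (fun a b c => by ext i; fin_cases i <;> simp [octMul] <;> ring)
    (fun a b c => by ext i; fin_cases i <;> simp [octMul] <;> ring)

/-- The map `x ↦ a x`. -/
def octMulLeft (a : Fin 8 → F) : (Fin 8 → F) →ₗ[F] (Fin 8 → F) := octMulBilin a

/-- The map `x ↦ x a`. -/
def octMulRight (a : Fin 8 → F) : (Fin 8 → F) →ₗ[F] (Fin 8 → F) := octMulBilin.flip a

@[simp] lemma octMulLeft_apply (a x : Fin 8 → F) : octMulLeft a x = octMul a x := rfl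

@[simp] lemma octMulRight_apply (a x : Fin 8 → F) : octMulRight a x = octMul x a := rfl

@[simp] lemma octMul_zero (a : Fin 8 → F) : octMul a 0 = 0 := (octMulLeft a).map_zero

@[simp] lemma zero_octMul (a : Fin 8 → F) : octMul 0 a = 0 := (octMulRight a).map_zero

@[simp] lemma octConj_octConj (a : Fin 8 → F) : octConj (octConj a) = a := by
  ext i; fin_cases i <;> simp [octConj]

@[simp] lemma octConj_zero : octConj (0 : Fin 8 → F) = 0 := by
  ext i; fin_cases i <;> simp [octConj]

@[simp] lemma octConj_eq_zero {a : Fin 8 → F} : octConj a = 0 ↔ a = 0 :=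
  ⟨fun h => by rw [← octConj_octConj a, h, octConj_zero], fun h => by rw [h, octConj_zero]⟩

@[simp] lemma octN_octConj (a : Fin 8 → F) : octN (octConj a) = octN a := by
  simp [octN, octConj]; ring

lemma octConj_octMul (a b : Fin 8 → F) :
    octConj (octMul a b) = octMul (octConj b) (octConj a) := by
  ext i; fin_cases i <;> simp [octConj, octMul] <;> ring

lemma octConj_eq (a : Fin 8 → F) : octConj a = octTr a • octOne - a := by
  ext i; fin_cases i <;> simp [octConj, octTr, octOne]

lemma octMul_octOne (a : Fin 8 → F) : octMul a octOne = a := by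
  ext i; fin_cases i <;> simp [octMul, octOne]

lemma octOne_octMul (a : Fin 8 → F) : octMul octOne a = a := by
  ext i; fin_cases i <;> simp [octMul, octOne]

lemma octMul_octConj_right (x a : Fin 8 → F) :
    octMul x (octConj a) = octTr a • x - octMul x a := by
  rw [octConj_eq, ← octMulLeft_apply, map_sub, map_smul]
  simp [octMul_octOne]

lemma octMul_octConj_left (a x : Fin 8 → F) :
    octMul (octConj a) x = octTr a • x - octMul a x := by
  rw [octConj_eq, ← octMulRight_apply, map_sub, map_smul]
  simp [octOne_octMul]

lemma octB_octOne (a : Fin 8 → F) : octB a octOne = octTr a := by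
  simp [octB, octN, octOne, octTr]; ring

lemma octConj_octMul_octMul_add (a b x : Fin 8 → F) :
    octMul (octConj a) (octMul b x) + octMul (octConj b) (octMul a x) = octB a b • x := by
  ext i; fin_cases i <;> simp [octConj, octMul, octB, octN] <;> ring

lemma octMul_octMul_octConj_add (a b x : Fin 8 → F) :
    octMul (octMul x a) (octConj b) + octMul (octMul x b) (octConj a) = octB a b • x := by
  ext i; fin_cases i <;> simp [octConj, octMul, octB, octN] <;> ring

lemma octConj_octMul_octMul (a x : Fin 8 → F) :
    octMul (octConj a) (octMul a x) = octN a • x := by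
  ext i; fin_cases i <;> simp [octConj, octMul, octN] <;> ring

lemma octMul_octMul_octConj (a x : Fin 8 → F) :
    octMul (octMul x a) (octConj a) = octN a • x := by
  ext i; fin_cases i <;> simp [octConj, octMul, octN] <;> ring

lemma octN_left_eq_zero {a b : Fin 8 → F} (hb : b ≠ 0) (h : octMul a b = 0) : octN a = 0 := by
  have := octConj_octMul_octMul a b
  rw [h, octMul_zero] at this
  exact (smul_eq_zero.1 this.symm).resolve_right hb

lemma octN_right_eq_zero {a b : Fin 8 → F} (ha : a ≠ 0) (h : octMul a b = 0) : octN b = 0 := by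
  have := octMul_octMul_octConj b a
  rw [h, zero_octMul] at this
  exact (smul_eq_zero.1 this.symm).resolve_right ha

/-- The polar form of the norm as a bilinear form. -/
def octBForm : LinearMap.BilinForm F (Fin 8 → F) :=
  LinearMap.mk₂ F octB
    (fun a b c => by simp [octB, octN]; ring)
    (fun a b c => by simp [octB, octN]; ring)
    (fun a b c => by simp [octB, octN]; ring)
    (fun a b c => by simp [octB, octN]; ring)

@[simp] lemma octBForm_apply (a b : Fin 8 → F) : octBForm a b = octB a b := rfl

lemma octB_comm (a b : Fin 8 → F) : octB a b = octB b a := by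
  simp [octB, octN]; ring

lemma octBForm_isRefl : (octBForm (F := F)).IsRefl := fun a b h => by
  rw [octBForm_apply] at *; rwa [octB_comm]

lemma octB_single (a : Fin 8 → F) (i : Fin 8) : octB a (Pi.single i 1) = a i.rev := by
  fin_cases i <;> simp [octB, octN, Fin.rev] <;> ring

lemma exists_octB_ne_zero {a : Fin 8 → F} (ha : a ≠ 0) : ∃ u, octB a u ≠ 0 := by
  obtain ⟨i, hi⟩ := Function.ne_iff.1 ha
  exact ⟨Pi.single i.rev 1, by simpa [octB_single] using hi⟩

lemma exists_octB_eq {a : Fin 8 → F} (ha : a ≠ 0) (c : F) : ∃ u, octB a u = c := by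
  obtain ⟨u, hu⟩ := exists_octB_ne_zero ha
  refine ⟨(c / octB a u) • u, ?_⟩
  rw [← octBForm_apply, map_smul, octBForm_apply, smul_eq_mul, div_mul_cancel₀ _ hu]

lemma octBForm_nondegenerate : (octBForm (F := F)).Nondegenerate := by
  refine (LinearMap.IsRefl.nondegenerate_iff_separatingLeft
    (fun a b h => octBForm_isRefl a b h)).2 fun a h => ?_
  by_contra ha
  obtain ⟨u, hu⟩ := exists_octB_ne_zero ha
  exact hu (h u)

/-- A totally singular subspace has dimension at most four. -/
lemma finrank_le_four_of_octN_eq_zero (W : Submodule F (Fin 8 → F))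
    (hW : ∀ x ∈ W, octN x = 0) : Module.finrank F W ≤ 4 := by
  have hle : W ≤ octBForm.orthogonal W := fun x hx y hy => by
    change octB y x = 0
    simp [octB, hW _ hx, hW _ hy, hW _ (W.add_mem hy hx)]
  have h₁ := Submodule.finrank_mono hle
  rw [LinearMap.BilinForm.finrank_orthogonal octBForm_nondegenerate,
    Module.finrank_fin_fun] at h₁
  omega

lemma finrank_ker_eq_four {f g : (Fin 8 → F) →ₗ[F] (Fin 8 → F)} (h : g.ker = f.range)
    (hf : ∀ x ∈ f.ker, octN x = 0) (hg : ∀ x ∈ g.ker, octN x = 0) :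
    Module.finrank F f.ker = 4 := by
  have h₁ := finrank_le_four_of_octN_eq_zero _ hf
  have h₂ := finrank_le_four_of_octN_eq_zero _ hg
  have h₃ := f.finrank_range_add_finrank_ker
  rw [← h, Module.finrank_fin_fun] at h₃
  omega

lemma ker_octMulRight_eq_range {a : Fin 8 → F} (ha : a ≠ 0) (hN : octN a = 0) :
    (octMulRight a).ker = (octMulRight (octConj a)).range := by
  ext x
  simp only [LinearMap.mem_ker, LinearMap.mem_range, octMulRight_apply]
  constructor
  · intro h
    obtain ⟨u, hu⟩ := exists_octB_eq ha 1
    refine ⟨octMul x u, ?_⟩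
    simpa [h, hu] using octMul_octMul_octConj_add a u x
  · rintro ⟨y, rfl⟩
    simpa [hN] using octMul_octMul_octConj (octConj a) y

lemma ker_octMulLeft_eq_range {a : Fin 8 → F} (ha : a ≠ 0) (hN : octN a = 0) :
    (octMulLeft a).ker = (octMulLeft (octConj a)).range := by
  ext x
  simp only [LinearMap.mem_ker, LinearMap.mem_range, octMulLeft_apply]
  constructor
  · intro h
    obtain ⟨u, hu⟩ := exists_octB_eq ha 1
    refine ⟨octMul u x, ?_⟩
    simpa [h, hu] using octConj_octMul_octMul_add a u x
  · rintro ⟨y, rfl⟩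
    simpa [hN] using octConj_octMul_octMul (octConj a) y

lemma finrank_ker_octMulRight {a : Fin 8 → F} (ha : a ≠ 0) (hN : octN a = 0) :
    Module.finrank F (octMulRight a).ker = 4 := by
  have ha' : octConj a ≠ 0 := by simpa using ha
  refine finrank_ker_eq_four (g := octMulRight (octConj a)) ?_
    (fun x hx => octN_left_eq_zero ha hx) (fun x hx => octN_left_eq_zero ha' hx)
  simpa using ker_octMulRight_eq_range ha' (by simpa using hN)

lemma finrank_ker_octMulLeft {a : Fin 8 → F} (ha : a ≠ 0) (hN : octN a = 0) :
    Module.finrank F (octMulLeft a).ker = 4 := by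
  have ha' : octConj a ≠ 0 := by simpa using ha
  refine finrank_ker_eq_four (g := octMulLeft (octConj a)) ?_
    (fun x hx => octN_right_eq_zero ha hx) (fun x hx => octN_right_eq_zero ha' hx)
  simpa using ker_octMulLeft_eq_range ha' (by simpa using hN)

lemma octMul_octMul_octConj_of_octMul_eq_zero {a b : Fin 8 → F} (h : octMul a b = 0)
    (y : Fin 8 → F) :
    octMul b (octMul y (octConj a)) = octB (octConj b) y • octConj a := by
  simpa [← octConj_octMul, h] using octConj_octMul_octMul_add (octConj b) y (octConj a)

lemma finrank_ker_octMulRight_inf_ker_octMulLeft {a b : Fin 8 → F} (ha : a ≠ 0) (hb : b ≠ 0)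
    (h : octMul a b = 0) :
    Module.finrank F ↥((octMulRight a).ker ⊓ (octMulLeft b).ker) = 3 := by
  have hN := octN_left_eq_zero hb h
  have hrange : ((octMulLeft b).domRestrict (octMulRight a).ker).range = Submodule.span F {octConj a} := by
    rw [LinearMap.range_domRestrict, ker_octMulRight_eq_range ha hN]
    ext z
    simp only [Submodule.mem_map, LinearMap.mem_range, octMulRight_apply, octMulLeft_apply,
      exists_exists_eq_and, octMul_octMul_octConj_of_octMul_eq_zero h,
      Submodule.mem_span_singleton]
    constructor
    · rintro ⟨y, rfl⟩
      exact ⟨_, rfl⟩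
    · rintro ⟨c, rfl⟩
      obtain ⟨y, rfl⟩ := exists_octB_eq (a := octConj b) (by simpa using hb) c
      exact ⟨y, rfl⟩
  have hsum := ((octMulLeft b).domRestrict (octMulRight a).ker).finrank_range_add_finrank_ker
  rw [hrange, finrank_span_singleton (by simpa using ha), finrank_ker_octMulRight ha hN,
    LinearMap.ker_domRestrict, ← Submodule.finrank_map_subtype_eq,
    Submodule.map_comap_subtype] at hsum
  omega

lemma ker_octMulRight_inf_ker_octMulLeft_eq_span {a : Fin 8 → F} (hN : octN a = 0)
    (ht : octTr a ≠ 0) :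
    (octMulRight a).ker ⊓ (octMulLeft a).ker = Submodule.span F {octConj a} := by
  ext x
  simp only [Submodule.mem_inf, LinearMap.mem_ker, octMulRight_apply, octMulLeft_apply,
    Submodule.mem_span_singleton]
  have hl : octMul (octConj a) a = 0 := by
    simpa [hN, octMul_octOne] using octConj_octMul_octMul a octOne
  have hr : octMul a (octConj a) = 0 := by
    simpa [hN, octOne_octMul] using octMul_octMul_octConj a octOne
  constructor
  · rintro ⟨h₁, h₂⟩
    have key := octConj_octMul_octMul_add a x (octConj a)
    rw [hr, octMul_zero, add_zero, octMul_octConj_right x a, h₁, sub_zero, ← octMulLeft_apply,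
      map_smul, octMulLeft_apply, octMul_octConj_left, h₂, sub_zero, smul_smul] at key
    refine ⟨(octTr a * octTr a)⁻¹ * octB a x, ?_⟩
    rw [mul_smul, ← key, inv_smul_smul₀ (mul_ne_zero ht ht)]
  · rintro ⟨c, rfl⟩
    rw [← octMulRight_apply, ← octMulLeft_apply, map_smul, map_smul]
    simp [hl, hr]

end Octonion

/-- If `D, E` are nonzero octonions with `DE = 0`, then
`N(D) = N(E) = 0`; the left annihilator `{x : xD = 0}` and the right annihilator
`{x : Dx = 0}` of `D` are `4`-dimensional `F_q`-subspaces of `O` on which `N`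
vanishes identically; `ann_L(D) ∩ ann_R(D)` has dimension `3` if `B(D,1) = 0`
and dimension `1` otherwise; and `ann_L(D) ∩ ann_R(E)` has dimension `3`. -/
theorem stmt_2 {F : Type*} [Field F] [Fintype F] (D E : Fin 8 → F)
    (hD : D ≠ 0) (hE : E ≠ 0) (hDE : octMul D E = 0) :
    octN D = 0 ∧ octN E = 0 ∧
    (∃ L : Submodule F (Fin 8 → F), (L : Set (Fin 8 → F)) = {x | octMul x D = 0} ∧
      Module.finrank F L = 4 ∧ ∀ x ∈ L, octN x = 0) ∧
    (∃ R : Submodule F (Fin 8 → F), (R : Set (Fin 8 → F)) = {x | octMul D x = 0} ∧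
      Module.finrank F R = 4 ∧ ∀ x ∈ R, octN x = 0) ∧
    (∃ W : Submodule F (Fin 8 → F),
      (W : Set (Fin 8 → F)) = {x | octMul x D = 0} ∩ {x | octMul D x = 0} ∧
      Module.finrank F W = if octB D octOne = 0 then 3 else 1) ∧
    (∃ W : Submodule F (Fin 8 → F),
      (W : Set (Fin 8 → F)) = {x | octMul x D = 0} ∩ {x | octMul E x = 0} ∧
      Module.finrank F W = 3) := by
  have hND := octN_left_eq_zero hE hDE
  refine ⟨hND, octN_right_eq_zero hD hDE,
    ⟨(octMulRight D).ker, rfl, finrank_ker_octMulRight hD hND,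
      fun x hx => octN_left_eq_zero hD hx⟩,
    ⟨(octMulLeft D).ker, rfl, finrank_ker_octMulLeft hD hND,
      fun x hx => octN_right_eq_zero hD hx⟩,
    ⟨(octMulRight D).ker ⊓ (octMulLeft D).ker, rfl, ?_⟩,
    ⟨(octMulRight D).ker ⊓ (octMulLeft E).ker, rfl,
      finrank_ker_octMulRight_inf_ker_octMulLeft hD hE hDE⟩⟩
  rw [octB_octOne]
  split_ifs with ht
  · have hDD : octMul D D = 0 := by
      have := octConj_octMul_octMul D octOne
      rwa [octMul_octOne, octMul_octConj_left, ht, hND, zero_smul, zero_smul, zero_sub,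
        neg_eq_zero] at this
    exact finrank_ker_octMulRight_inf_ker_octMulLeft hD hD hDD
  · rw [ker_octMulRight_inf_ker_octMulLeft_eq_span hND ht,
      finrank_span_singleton (by simpa using hD)]
end

section
/- Suppose q > 2, and let G be the group of F_q-algebra automorphisms of O. Then every element of G fixes the identity 1 and preserves both Tr and N; and for any two octonions u, v ∈ O that are not scalar multiples of 1, there exists g ∈ G with g(u) = v if and only if Tr(u) = Tr(v) and N(u) = N(v). -/
/-!  The split octonion algebra `O` over a finite field `F` of order `q`,
represented as `Fin 8 → F` with coordinates with respect to the basis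
`x_1, …, x_8` (index `i : Fin 8` corresponds to `x_{i+1}`). -/

variable {F : Type*}

/-- Two octonions are conjugate when some algebra automorphism maps one to the other. -/
def OctConjugate [Field F] (u v : Fin 8 → F) : Prop :=
  ∃ g : (Fin 8 → F) ≃ₗ[F] (Fin 8 → F),
    (∀ x y, g (octMul x y) = octMul (g x) (g y)) ∧ g u = v

namespace OctConjugate

variable [Field F] {u v w : Fin 8 → F}

theorem symm (h : OctConjugate u v) : OctConjugate v u := by
  obtain ⟨g, hg, rfl⟩ := h
  refine ⟨g.symm, fun x y => g.injective ?_, g.symm_apply_apply u⟩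
  simp [hg]

theorem trans (h : OctConjugate u v) (h' : OctConjugate v w) : OctConjugate u w := by
  obtain ⟨g, hg, rfl⟩ := h
  obtain ⟨k, hk, rfl⟩ := h'
  exact ⟨g.trans k, fun x y => by simp [hg, hk], rfl⟩

end OctConjugate

theorem octMul_one [Field F] (a : Fin 8 → F) : octMul a octOne = a := by
  ext i; fin_cases i <;> simp [octMul, octOne]

theorem one_octMul [Field F] (a : Fin 8 → F) : octMul octOne a = a := by
  ext i; fin_cases i <;> simp [octMul, octOne]

theorem octOne_ne_zero [Field F] : (octOne : Fin 8 → F) ≠ 0 :=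
  fun h => by simpa [octOne] using congrFun h 3

/-- Every octonion is a root of its characteristic polynomial. -/
theorem octMul_self [Field F] (a : Fin 8 → F) :
    octMul a a = octTr a • a - octN a • octOne := by
  ext i; fin_cases i <;> simp [octMul, octOne, octTr, octN] <;> ring

section Automorphism

variable [Field F] {g : (Fin 8 → F) ≃ₗ[F] (Fin 8 → F)}

theorem map_octOne (hg : ∀ x y, g (octMul x y) = octMul (g x) (g y)) : g octOne = octOne := by
  have h := hg octOne (g.symm octOne)
  rwa [one_octMul, g.apply_symm_apply, octMul_one, eq_comm] at h

theorem octTr_map_and_octN_map (hg : ∀ x y, g (octMul x y) = octMul (g x) (g y))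
    (x : Fin 8 → F) : octTr (g x) = octTr x ∧ octN (g x) = octN x := by
  have h1 := map_octOne hg
  have h := octMul_self (g x)
  rw [← hg, octMul_self, map_sub, map_smul, map_smul, h1] at h
  have key : (octTr (g x) - octTr x) • g x = (octN (g x) - octN x) • octOne := by
    rw [sub_smul, sub_smul, sub_eq_sub_iff_sub_eq_sub]
    exact h.symm
  by_cases ht : octTr (g x) = octTr x
  · rw [ht, sub_self, zero_smul, eq_comm, smul_eq_zero, sub_eq_zero] at key
    exact ⟨ht, key.resolve_right octOne_ne_zero⟩
  · have hgx : g x = ((octTr (g x) - octTr x)⁻¹ * (octN (g x) - octN x)) • octOne := by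
      rw [mul_smul, ← key, inv_smul_smul₀ (sub_ne_zero.2 ht)]
    have hx : g x = x := by
      apply g.injective
      rw [hgx, map_smul, h1]
    simp [hx]

end Automorphism

section RootElements

variable [Field F]

/-- The long root automorphism acting by the transvection `λ₁ ↦ λ₁ + sλ₆`. -/
def octLong₁₆ (s : F) : (Fin 8 → F) ≃ₗ[F] (Fin 8 → F) where
  toFun a := ![a 0 + s * a 5, a 1, a 2 - s * a 7, a 3, a 4, a 5, a 6, a 7]
  invFun a := ![a 0 - s * a 5, a 1, a 2 + s * a 7, a 3, a 4, a 5, a 6, a 7]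
  map_add' a b := by ext i; fin_cases i <;> simp <;> ring
  map_smul' c a := by ext i; fin_cases i <;> simp <;> ring
  left_inv a := by ext i; fin_cases i <;> simp
  right_inv a := by ext i; fin_cases i <;> simp

/-- The long root automorphism acting by the transvection `λ₁ ↦ λ₁ + sλ₇`. -/
def octLong₁₇ (s : F) : (Fin 8 → F) ≃ₗ[F] (Fin 8 → F) where
  toFun a := ![a 0 + s * a 6, a 1 - s * a 7, a 2, a 3, a 4, a 5, a 6, a 7]
  invFun a := ![a 0 - s * a 6, a 1 + s * a 7, a 2, a 3, a 4, a 5, a 6, a 7]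
  map_add' a b := by ext i; fin_cases i <;> simp <;> ring
  map_smul' c a := by ext i; fin_cases i <;> simp <;> ring
  left_inv a := by ext i; fin_cases i <;> simp
  right_inv a := by ext i; fin_cases i <;> simp

/-- The long root automorphism acting by the transvection `λ₆ ↦ λ₆ + sλ₁`. -/
def octLong₆₁ (s : F) : (Fin 8 → F) ≃ₗ[F] (Fin 8 → F) where
  toFun a := ![a 0, a 1, a 2, a 3, a 4, a 5 + s * a 0, a 6, a 7 - s * a 2]
  invFun a := ![a 0, a 1, a 2, a 3, a 4, a 5 - s * a 0, a 6, a 7 + s * a 2]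
  map_add' a b := by ext i; fin_cases i <;> simp <;> ring
  map_smul' c a := by ext i; fin_cases i <;> simp <;> ring
  left_inv a := by ext i; fin_cases i <;> simp
  right_inv a := by ext i; fin_cases i <;> simp

/-- The long root automorphism acting by the transvection `λ₇ ↦ λ₇ + sλ₁`. -/
def octLong₇₁ (s : F) : (Fin 8 → F) ≃ₗ[F] (Fin 8 → F) where
  toFun a := ![a 0, a 1, a 2, a 3, a 4, a 5, a 6 + s * a 0, a 7 - s * a 1]
  invFun a := ![a 0, a 1, a 2, a 3, a 4, a 5, a 6 - s * a 0, a 7 + s * a 1]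
  map_add' a b := by ext i; fin_cases i <;> simp <;> ring
  map_smul' c a := by ext i; fin_cases i <;> simp <;> ring
  left_inv a := by ext i; fin_cases i <;> simp
  right_inv a := by ext i; fin_cases i <;> simp

/-- A short root automorphism, which moves the diagonal coordinates `λ₄, λ₅` by `± tλ₁`. -/
def octShort (t : F) : (Fin 8 → F) ≃ₗ[F] (Fin 8 → F) where
  toFun a := ![a 0, a 1, a 2, a 3 + t * a 0, a 4 - t * a 0, a 5 + t * a 1, a 6 - t * a 2,
    a 7 + t * (a 3 - a 4) + t ^ 2 * a 0]
  invFun a := ![a 0, a 1, a 2, a 3 - t * a 0, a 4 + t * a 0, a 5 - t * a 1, a 6 + t * a 2,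
    a 7 - t * (a 3 - a 4) + t ^ 2 * a 0]
  map_add' a b := by ext i; fin_cases i <;> simp <;> ring
  map_smul' c a := by ext i; fin_cases i <;> simp <;> ring
  left_inv a := by ext i; fin_cases i <;> simp; ring
  right_inv a := by ext i; fin_cases i <;> simp; ring

theorem octConjugate_long₁₆ (s : F) (u : Fin 8 → F) : OctConjugate u
    ![u 0 + s * u 5, u 1, u 2 - s * u 7, u 3, u 4, u 5, u 6, u 7] := by
  refine ⟨octLong₁₆ s, fun x y => ?_, rfl⟩
  ext i; fin_cases i <;> simp [octLong₁₆, octMul] <;> ring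

theorem octConjugate_long₁₇ (s : F) (u : Fin 8 → F) : OctConjugate u
    ![u 0 + s * u 6, u 1 - s * u 7, u 2, u 3, u 4, u 5, u 6, u 7] := by
  refine ⟨octLong₁₇ s, fun x y => ?_, rfl⟩
  ext i; fin_cases i <;> simp [octLong₁₇, octMul] <;> ring

theorem octConjugate_long₆₁ (s : F) (u : Fin 8 → F) : OctConjugate u
    ![u 0, u 1, u 2, u 3, u 4, u 5 + s * u 0, u 6, u 7 - s * u 2] := by
  refine ⟨octLong₆₁ s, fun x y => ?_, rfl⟩
  ext i; fin_cases i <;> simp [octLong₆₁, octMul] <;> ring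

theorem octConjugate_long₇₁ (s : F) (u : Fin 8 → F) : OctConjugate u
    ![u 0, u 1, u 2, u 3, u 4, u 5, u 6 + s * u 0, u 7 - s * u 1] := by
  refine ⟨octLong₇₁ s, fun x y => ?_, rfl⟩
  ext i; fin_cases i <;> simp [octLong₇₁, octMul] <;> ring

theorem octConjugate_short (t : F) (u : Fin 8 → F) : OctConjugate u
    ![u 0, u 1, u 2, u 3 + t * u 0, u 4 - t * u 0, u 5 + t * u 1, u 6 - t * u 2,
      u 7 + t * (u 3 - u 4) + t ^ 2 * u 0] := by
  refine ⟨octShort t, fun x y => ?_, rfl⟩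
  ext i; fin_cases i <;> simp [octShort, octMul] <;> ring

end RootElements

section NormalForm

variable [Field F]

/-- A nonscalar octonion is conjugate to one whose component along `x₁, x₆, x₇` is nonzero. -/
theorem exists_octConjugate_upper_ne_zero {u : Fin 8 → F} (hu : ∀ c : F, u ≠ c • octOne) :
    ∃ v, OctConjugate u v ∧ (v 0 ≠ 0 ∨ v 5 ≠ 0 ∨ v 6 ≠ 0) := by
  by_contra! H
  have long : ∀ v, OctConjugate u v → v 7 = 0 := by
    intro v hv
    have e := (H _ (hv.trans (octConjugate_short 1 v))).2.2
    have e' := (H _ ((hv.trans (octConjugate_long₁₆ 1 v)).trans (octConjugate_short 1 _))).2.2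
    simp at e e'
    linear_combination e' - e
  have hrefl : OctConjugate u u := (octConjugate_short 0 u).trans (octConjugate_short 0 u).symm
  obtain ⟨h0, h5, h6⟩ := H u hrefl
  have hs := octConjugate_short 1 u
  obtain ⟨-, e5, e6⟩ := H _ hs
  have h7 := long u hrefl
  have e7 := long _ hs
  simp [h0, h5, h6, h7, sub_eq_zero] at e5 e6 e7
  apply hu (u 3)
  ext i; fin_cases i <;> simp [octOne, *]

/-- An octonion with nonzero component along `x₁, x₆, x₇` can be moved, without changing its
diagonal, so that this component becomes `x₁`. -/
theorem exists_octConjugate_upper_eq {u : Fin 8 → F} (hu : u 0 ≠ 0 ∨ u 5 ≠ 0 ∨ u 6 ≠ 0) :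
    ∃ v, OctConjugate u v ∧ v 0 = 1 ∧ v 5 = 0 ∧ v 6 = 0 ∧ v 3 = u 3 ∧ v 4 = u 4 := by
  have of_one : ∀ u : Fin 8 → F, u 0 = 1 →
      ∃ v, OctConjugate u v ∧ v 0 = 1 ∧ v 5 = 0 ∧ v 6 = 0 ∧ v 3 = u 3 ∧ v 4 = u 4 :=
    fun u h => ⟨_, (octConjugate_long₆₁ (-u 5) u).trans (octConjugate_long₇₁ (-u 6) _),
      by simp [h]⟩
  have of_five : ∀ u : Fin 8 → F, u 5 ≠ 0 →
      ∃ v, OctConjugate u v ∧ v 0 = 1 ∧ v 5 = 0 ∧ v 6 = 0 ∧ v 3 = u 3 ∧ v 4 = u 4 := by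
    intro u h
    obtain ⟨v, hv, H⟩ := of_one _
      (show (![u 0 + (1 - u 0) / u 5 * u 5, u 1, u 2 - (1 - u 0) / u 5 * u 7, u 3, u 4, u 5,
        u 6, u 7] : Fin 8 → F) 0 = 1 by simp [h])
    exact ⟨v, (octConjugate_long₁₆ _ u).trans hv, by simpa using H⟩
  by_cases h5 : u 5 = 0
  · by_cases h0 : u 0 = 0
    · have h6 : u 6 ≠ 0 := by simpa [h0, h5] using hu
      obtain ⟨v, hv, H⟩ := of_one _
        (show (![u 0 + (u 6)⁻¹ * u 6, u 1 - (u 6)⁻¹ * u 7, u 2, u 3, u 4, u 5, u 6, u 7] :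
          Fin 8 → F) 0 = 1 by simp [h0, h6])
      exact ⟨v, (octConjugate_long₁₇ _ u).trans hv, by simpa using H⟩
    · obtain ⟨v, hv, H⟩ := of_five _
        (show (![u 0, u 1, u 2, u 3, u 4, u 5 + 1 * u 0, u 6, u 7 - 1 * u 2] :
          Fin 8 → F) 5 ≠ 0 by simp [h0, h5])
      exact ⟨v, (octConjugate_long₆₁ _ u).trans hv, by simpa using H⟩
  · exact of_five u h5

theorem OctConjugate.octTr_eq {u v : Fin 8 → F} (h : OctConjugate u v) : octTr u = octTr v := by
  obtain ⟨g, hg, rfl⟩ := h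
  exact (octTr_map_and_octN_map hg u).1.symm

theorem OctConjugate.octN_eq {u v : Fin 8 → F} (h : OctConjugate u v) : octN u = octN v := by
  obtain ⟨g, hg, rfl⟩ := h
  exact (octTr_map_and_octN_map hg u).2.symm

/-- A nonscalar octonion is determined up to conjugacy by its trace and norm: it is conjugate to
`x₁ + αx₄ + (Tr(u) - α)x₅ + βx₈` for any `α` such that `β = N(u) - α(Tr(u) - α)` is nonzero. -/
theorem octConjugate_normalForm {u : Fin 8 → F} (hu : ∀ c : F, u ≠ c • octOne) {α : F}
    (hα : octN u - α * (octTr u - α) ≠ 0) :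
    OctConjugate u ![1, 0, 0, α, octTr u - α, 0, 0, octN u - α * (octTr u - α)] := by
  obtain ⟨v, huv, hv⟩ := exists_octConjugate_upper_ne_zero hu
  obtain ⟨w, hvw, hw, -⟩ := exists_octConjugate_upper_eq hv
  have hwx := octConjugate_short (α - w 3) w
  obtain ⟨y, hxy, y0, y5, y6, y3, -⟩ := exists_octConjugate_upper_eq (u := ![w 0, w 1, w 2,
    w 3 + (α - w 3) * w 0, w 4 - (α - w 3) * w 0, w 5 + (α - w 3) * w 1, w 6 - (α - w 3) * w 2,
    w 7 + (α - w 3) * (w 3 - w 4) + (α - w 3) ^ 2 * w 0]) (by simp [hw])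
  have huy := ((huv.trans hvw).trans hwx).trans hxy
  have y3 : y 3 = α := by simpa [hw] using y3
  have y4 : y 4 = octTr u - α := by rw [huy.octTr_eq, octTr, y3]; ring
  have y7 : y 7 = octN u - α * (octTr u - α) := by
    rw [← y4, huy.octN_eq, octN, y0, y3, y5, y6]; ring
  have y7' : y 7 ≠ 0 := y7 ▸ hα
  have hyz := (octConjugate_long₁₆ (y 2 / y 7) y).trans (octConjugate_long₁₇ (y 1 / y 7) _)
  convert huy.trans hyz using 1
  rw [← y7, ← y4]
  ext i; fin_cases i <;> simp [y0, y3, y5, y6, y7']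

end NormalForm

/-- Over a finite field with more than two elements, some element avoids the roots of a
monic quadratic polynomial. -/
theorem exists_sub_mul_sub_ne_zero [Field F] [Fintype F] (hq : 2 < Fintype.card F) (t n : F) :
    ∃ α : F, n - α * (t - α) ≠ 0 := by
  classical
  by_contra! H
  obtain ⟨a, b, c, hab, hac, hbc⟩ := Fintype.two_lt_card_iff.1 hq
  have key : ∀ x, a ≠ x → a + x = t := fun x hx => by
    have h : (a - x) * (a + x - t) = 0 := by linear_combination H a - H x
    exact sub_eq_zero.1 ((mul_eq_zero.1 h).resolve_left (sub_ne_zero.2 hx))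
  exact hbc (add_left_cancel ((key b hab).trans (key c hac).symm))

/-- Suppose `q > 2` and let `G = G_2(q)` be the group of
`F_q`-algebra automorphisms of `O` (i.e. `F_q`-linear bijections preserving the
multiplication).  Every element of `G` fixes `1` and preserves `Tr` and `N`;
and for octonions `u, v` that are not scalar multiples of `1`, some `g ∈ G`
maps `u` to `v` if and only if `Tr(u) = Tr(v)` and `N(u) = N(v)`. -/
theorem stmt_4 {F : Type*} [Field F] [Fintype F] (hq : 2 < Fintype.card F) :
    (∀ g : (Fin 8 → F) ≃ₗ[F] (Fin 8 → F),
      (∀ x y, g (octMul x y) = octMul (g x) (g y)) →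
        g octOne = octOne ∧ (∀ x, octTr (g x) = octTr x) ∧ ∀ x, octN (g x) = octN x) ∧
    ∀ u v : Fin 8 → F, (∀ c : F, u ≠ c • octOne) → (∀ c : F, v ≠ c • octOne) →
      ((∃ g : (Fin 8 → F) ≃ₗ[F] (Fin 8 → F),
          (∀ x y, g (octMul x y) = octMul (g x) (g y)) ∧ g u = v) ↔
        octTr u = octTr v ∧ octN u = octN v) := by
  refine ⟨fun g hg => ⟨map_octOne hg, fun x => (octTr_map_and_octN_map hg x).1,
    fun x => (octTr_map_and_octN_map hg x).2⟩, fun u v hu hv => ⟨fun h => ?_, ?_⟩⟩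
  · exact ⟨OctConjugate.octTr_eq h, OctConjugate.octN_eq h⟩
  · rintro ⟨ht, hn⟩
    obtain ⟨α, hα⟩ := exists_sub_mul_sub_ne_zero hq (octTr u) (octN u)
    have huw := octConjugate_normalForm hu hα
    rw [ht, hn] at hα huw
    exact huw.trans (octConjugate_normalForm hv hα).symm
end

section
/- Suppose q > 2. The orbit of x_1 under the group of F_q-algebra automorphisms of O is exactly the set {α ∈ O : α ≠ 0, Tr(α) = 0, N(α) = 0}, and this orbit has cardinality q^6 − 1. -/
/-!  The split octonion algebra `O` over a finite field `F` of order `q`,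
represented as `Fin 8 → F` with coordinates with respect to the basis
`x_1, …, x_8` (index `i : Fin 8` corresponds to `x_{i+1}`). -/

variable {F : Type*}

/-- Two octonions are related if an algebra automorphism maps the first to the second. -/
def OctRel [Field F] (v w : Fin 8 → F) : Prop :=
  ∃ g : (Fin 8 → F) ≃ₗ[F] (Fin 8 → F),
    (∀ x y, g (octMul x y) = octMul (g x) (g y)) ∧ g v = w

theorem OctRel.symm [Field F] {v w : Fin 8 → F} (h : OctRel v w) : OctRel w v := by
  obtain ⟨g, hg, rfl⟩ := h
  refine ⟨g.symm, fun x y => g.injective ?_, g.symm_apply_apply v⟩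
  simp [hg]

theorem OctRel.trans [Field F] {u v w : Fin 8 → F} (h : OctRel u v) (h' : OctRel v w) :
    OctRel u w := by
  obtain ⟨g, hg, rfl⟩ := h
  obtain ⟨k, hk, rfl⟩ := h'
  exact ⟨g.trans k, fun x y => by simp [hg, hk], rfl⟩

/-- A linear multiplicative map with a left inverse is an automorphism. -/
theorem octRel_of_leftInverse [Field F] (f k : (Fin 8 → F) → (Fin 8 → F))
    (hf : IsLinearMap F f) (hmul : ∀ x y, f (octMul x y) = octMul (f x) (f y))
    (hk : Function.LeftInverse k f) (v : Fin 8 → F) : OctRel v (f v) :=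
  ⟨LinearEquiv.ofInjectiveEndo (hf.mk' f) hk.injective, hmul, rfl⟩

/-- The automorphism exchanging the idempotents `x_4` and `x_5`. -/
def octSwap (a : Fin 8 → F) : Fin 8 → F :=
  ![a 7, a 6, a 5, a 4, a 3, a 2, a 1, a 0]

/-- The automorphism permuting `x_1, x_6, x_7` and `x_8, x_3, x_2` cyclically. -/
def octCycle (a : Fin 8 → F) : Fin 8 → F :=
  ![a 6, a 2, a 7, a 3, a 4, a 0, a 5, a 1]

/-- The unipotent automorphism mapping `x_4` to `x_4 + p x_1 + r x_6 + s x_7`. -/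
def octUnip [Field F] (p r s : F) (a : Fin 8 → F) : Fin 8 → F :=
  ![a 0 + (a 3 - a 4 + (p * a 7 + r * a 2 + s * a 1)) * p,
    a 1 + (p * a 5 - r * a 0),
    a 2 + (s * a 0 - p * a 6),
    a 3 + (p * a 7 + r * a 2 + s * a 1),
    a 4 - (p * a 7 + r * a 2 + s * a 1),
    a 5 + (a 3 - a 4 + (p * a 7 + r * a 2 + s * a 1)) * r,
    a 6 + (a 3 - a 4 + (p * a 7 + r * a 2 + s * a 1)) * s,
    a 7 + (r * a 6 - s * a 5)]

/-- The automorphism fixing `x_4` and mapping `x_1` to `p x_1 + r x_6 + s x_7`, where `c = p⁻¹`. -/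
def octLower [Field F] (p c r s : F) (a : Fin 8 → F) : Fin 8 → F :=
  ![p * a 0, a 1, p * a 2, a 3, a 4, r * a 0 + c * a 5, s * a 0 + a 6,
    c * a 7 - r * a 2 - c * s * a 1]

theorem octRel_swap [Field F] (v : Fin 8 → F) : OctRel v (octSwap v) := by
  refine octRel_of_leftInverse octSwap octSwap ⟨fun x y => ?_, fun c x => ?_⟩
    (fun x y => ?_) (fun x => ?_) v <;> ext i <;> fin_cases i <;>
    simp [octSwap, octMul] <;> ring

theorem octRel_cycle [Field F] (v : Fin 8 → F) : OctRel v (octCycle v) := by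
  refine octRel_of_leftInverse octCycle (octCycle ∘ octCycle) ⟨fun x y => ?_, fun c x => ?_⟩
    (fun x y => ?_) (fun x => ?_) v <;> ext i <;> fin_cases i <;>
    simp [octCycle, octMul] <;> ring

theorem octRel_unip [Field F] (p r s : F) (v : Fin 8 → F) : OctRel v (octUnip p r s v) := by
  refine octRel_of_leftInverse (octUnip p r s) (octUnip (-p) (-r) (-s))
    ⟨fun x y => ?_, fun c x => ?_⟩ (fun x y => ?_) (fun x => ?_) v <;> ext i <;> fin_cases i <;>
    simp [octUnip, octMul] <;> ring

theorem octRel_lower [Field F] {p : F} (hp : p ≠ 0) (r s : F) (v : Fin 8 → F) :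
    OctRel v (octLower p p⁻¹ r s v) := by
  refine octRel_of_leftInverse (octLower p p⁻¹ r s)
    (fun a => ![p⁻¹ * a 0, a 1, p⁻¹ * a 2, a 3, a 4, p * a 5 - r * a 0,
      a 6 - p⁻¹ * s * a 0, p * a 7 + r * a 2 + s * a 1])
    ⟨fun x y => ?_, fun c x => ?_⟩ (fun x y => ?_) (fun x => ?_) v <;> ext i <;> fin_cases i <;>
    simp [octLower, octMul] <;> field_simp <;> ring

theorem octMul_self_eq_zero_iff [Field F] (a : Fin 8 → F) :
    octMul a a = 0 ↔ octTr a = 0 ∧ octN a = 0 := by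
  constructor
  · intro h
    have e (i : Fin 8) : octMul a a i = 0 := congrFun h i
    have e0 := e 0
    have e1 := e 1
    have e2 := e 2
    have e3 := e 3
    have e4 := e 4
    have e5 := e 5
    have e6 := e 6
    simp only [octMul, Matrix.cons_val] at e0 e1 e2 e3 e4 e5 e6
    have ht : a 3 + a 4 = 0 := by
      by_contra ht
      have h0 : a 0 = 0 := (mul_eq_zero.1 (by linear_combination e0 :
        (a 3 + a 4) * a 0 = 0)).resolve_left ht
      have h1 : a 1 = 0 := (mul_eq_zero.1 (by linear_combination e1 :
        (a 3 + a 4) * a 1 = 0)).resolve_left ht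
      have h2 : a 2 = 0 := (mul_eq_zero.1 (by linear_combination e2 :
        (a 3 + a 4) * a 2 = 0)).resolve_left ht
      simp [h0, h1, h2] at e3 e4
      simp [e3, e4] at ht
    refine ⟨ht, ?_⟩
    simp only [octN]
    linear_combination a 3 * ht - e3
  · rintro ⟨ht, hn⟩
    simp only [octTr, octN] at ht hn
    ext i
    fin_cases i <;> simp [octMul]
    · linear_combination a 0 * ht
    · linear_combination a 1 * ht
    · linear_combination a 2 * ht
    · linear_combination a 3 * ht - hn
    · linear_combination a 4 * ht - hn
    · linear_combination a 5 * ht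
    · linear_combination a 6 * ht
    · linear_combination a 7 * ht

theorem OctRel.null [Field F] {v w : Fin 8 → F} (h : OctRel v w)
    (hv : octTr v = 0 ∧ octN v = 0) : octTr w = 0 ∧ octN w = 0 := by
  obtain ⟨g, hg, rfl⟩ := h
  rw [← octMul_self_eq_zero_iff] at hv ⊢
  rw [← hg, hv, map_zero]

theorem octRel_x1_of_diag_eq_zero [Field F] {a : Fin 8 → F} (hn : octN a = 0)
    (h3 : a 3 = 0) (h4 : a 4 = 0) (h0 : a 0 ≠ 0) : OctRel a octX1 := by
  refine OctRel.trans ?_ (octRel_lower h0 (a 5) (a 6) octX1).symm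
  convert octRel_unip 0 (a 1 / a 0) (-(a 2 / a 0)) a using 1
  simp only [octN, h3, h4] at hn
  have h7 : a 7 = -(a 1 * a 6 + a 2 * a 5) / a 0 := by
    field_simp
    linear_combination hn
  have hk : 0 * a 7 + a 1 / a 0 * a 2 + -(a 2 / a 0) * a 1 = 0 := by ring
  ext i
  simp only [octUnip, hk]
  fin_cases i <;> simp [octLower, octX1, h3, h4, h7] <;> field_simp <;> ring

theorem octRel_x1_of_apply_seven_ne_zero [Field F] {a : Fin 8 → F}
    (ha : octTr a = 0 ∧ octN a = 0) (h7 : a 7 ≠ 0) : OctRel a octX1 := by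
  have h := (octRel_unip (-(a 3 / a 7)) 0 0 a).trans (octRel_swap _)
  have ht : a 3 + a 4 = 0 := ha.1
  refine h.trans (octRel_x1_of_diag_eq_zero (h.null ha).2 ?_ ?_ ?_)
  · simp [octSwap, octUnip, h7]
    linear_combination ht
  · simp [octSwap, octUnip, h7]
  · simpa [octSwap, octUnip] using h7

theorem octRel_x1_of_null [Field F] {a : Fin 8 → F} (h : a ≠ 0)
    (ha : octTr a = 0 ∧ octN a = 0) : OctRel a octX1 := by
  have hS : ∀ {b : Fin 8 → F}, OctRel (octSwap b) octX1 → OctRel b octX1 :=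
    fun hb => (octRel_swap _).trans hb
  have hC : ∀ {b : Fin 8 → F}, OctRel (octCycle b) octX1 → OctRel b octX1 :=
    fun hb => (octRel_cycle _).trans hb
  have H7 : ∀ {b : Fin 8 → F}, (octTr b = 0 ∧ octN b = 0) → b 7 ≠ 0 → OctRel b octX1 :=
    octRel_x1_of_apply_seven_ne_zero
  have H1 : ∀ {b : Fin 8 → F}, (octTr b = 0 ∧ octN b = 0) → b 1 ≠ 0 → OctRel b octX1 :=
    fun hb h1 => hC (H7 ((octRel_cycle _).null hb) h1)
  have H2 : ∀ {b : Fin 8 → F}, (octTr b = 0 ∧ octN b = 0) → b 2 ≠ 0 → OctRel b octX1 :=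
    fun hb h2 => hC (H1 ((octRel_cycle _).null hb) h2)
  have haS := (octRel_swap a).null ha
  by_contra hne
  have h0 : a 0 = 0 := not_not.1 fun h => hne (hS (H7 haS h))
  have h1 : a 1 = 0 := not_not.1 fun h => hne (H1 ha h)
  have h2 : a 2 = 0 := not_not.1 fun h => hne (H2 ha h)
  have h5 : a 5 = 0 := not_not.1 fun h => hne (hS (H2 haS h))
  have h6 : a 6 = 0 := not_not.1 fun h => hne (hS (H1 haS h))
  have h7 : a 7 = 0 := not_not.1 fun h => hne (H7 ha h)
  obtain ⟨ht, hn⟩ := ha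
  simp only [octTr, octN, h0, h1, h2] at ht hn
  have h3 : a 3 = 0 := by
    have : a 3 * a 3 = 0 := by linear_combination a 3 * ht - hn
    simpa using this
  have h4 : a 4 = 0 := by linear_combination ht - h3
  refine h (funext fun i => ?_)
  fin_cases i <;> assumption

theorem octOrbit_eq [Field F] :
    {v : Fin 8 → F | OctRel octX1 v} = {a | a ≠ 0 ∧ octTr a = 0 ∧ octN a = 0} := by
  ext v
  constructor
  · intro h
    refine ⟨?_, h.null (by simp [octTr, octN, octX1])⟩
    rintro rfl
    obtain ⟨g, -, hg⟩ := h
    have := congrFun ((map_eq_zero_iff g g.injective).1 hg) 0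
    simp [octX1] at this
  · rintro ⟨h, ha⟩
    exact (octRel_x1_of_null h ha).symm

/-- Number of solutions of `x * y = c t`: the pairs with `x ≠ 0` contribute one solution each. -/
theorem card_mul_eq_add [Field F] [Fintype F] {T : Type*} [Fintype T] (c : T → F) :
    Nat.card {z : T × F × F // z.2.1 * z.2.2 = c z.1} + Nat.card T =
      Nat.card F * Nat.card T + Nat.card F * Nat.card {t : T // c t = 0} := by
  classical
  have key (t : T) (x : F) : (∑ y : F, if x * y = c t then 1 else 0) +
      (if x = 0 then 1 else 0) =
      1 + if x = 0 then (if c t = 0 then Fintype.card F else 0) else 0 := by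
    by_cases hx : x = 0
    · by_cases hc : c t = 0
      · simp [hx, hc, add_comm]
      · simp [hx, hc, Ne.symm hc]
    · have (y : F) : x * y = c t ↔ y = x⁻¹ * c t := by
        rw [eq_inv_mul_iff_mul_eq₀ hx]
      simp [hx, this]
  have hsum := Finset.sum_congr rfl fun t (_ : t ∈ Finset.univ) =>
    Finset.sum_congr rfl fun x (_ : x ∈ Finset.univ) => key t x
  simp only [Finset.sum_add_distrib, Finset.sum_ite_eq', Finset.mem_univ, if_true,
    Finset.sum_const, Finset.card_univ, smul_eq_mul, mul_one] at hsum
  simp only [Nat.card_eq_fintype_card, Fintype.card_subtype, Finset.card_filter,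
    Fintype.sum_prod_type, Finset.mul_sum, mul_ite, mul_one, mul_zero]
  linarith

theorem card_octNull [Field F] [Fintype F] :
    {a : Fin 8 → F | octTr a = 0 ∧ octN a = 0}.ncard = Fintype.card F ^ 6 := by
  have e1 := card_mul_eq_add fun a : F => a ^ 2
  have e2 := card_mul_eq_add fun z : F × F × F => z.1 ^ 2 - z.2.1 * z.2.2
  have e3 := card_mul_eq_add fun z : (F × F × F) × F × F =>
    z.1.1 ^ 2 - z.1.2.1 * z.1.2.2 - z.2.1 * z.2.2
  have h0 : Nat.card {a : F // a ^ 2 = 0} = 1 := by simp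
  have h1 : Nat.card {z : F × F × F // z.1 ^ 2 - z.2.1 * z.2.2 = 0} =
      Nat.card {z : F × F × F // z.2.1 * z.2.2 = z.1 ^ 2} :=
    Nat.card_congr (Equiv.subtypeEquivRight fun z => by rw [sub_eq_zero, eq_comm])
  have h2 : Nat.card {z : (F × F × F) × F × F //
        z.1.1 ^ 2 - z.1.2.1 * z.1.2.2 - z.2.1 * z.2.2 = 0} =
      Nat.card {z : (F × F × F) × F × F // z.2.1 * z.2.2 = z.1.1 ^ 2 - z.1.2.1 * z.1.2.2} :=
    Nat.card_congr (Equiv.subtypeEquivRight fun z => by rw [sub_eq_zero, eq_comm])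
  have h3 : Nat.card {a : Fin 8 → F // octTr a = 0 ∧ octN a = 0} =
      Nat.card {z : ((F × F × F) × F × F) × F × F //
        z.2.1 * z.2.2 = z.1.1.1 ^ 2 - z.1.1.2.1 * z.1.1.2.2 - z.1.2.1 * z.1.2.2} := by
    refine Nat.card_congr
      { toFun := fun a => ⟨(((a.1 3, a.1 0, a.1 7), a.1 1, a.1 6), a.1 2, a.1 5), ?_⟩
        invFun := fun z => ⟨![z.1.1.1.2.1, z.1.1.2.1, z.1.2.1, z.1.1.1.1, -z.1.1.1.1,
          z.1.2.2, z.1.1.2.2, z.1.1.1.2.2], ?_⟩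
        left_inv := ?_
        right_inv := fun z => rfl }
    · obtain ⟨a, ht, hn⟩ := a
      simp only [octTr, octN] at ht hn ⊢
      linear_combination hn - a 3 * ht
    · have hz := z.2
      refine ⟨by simp [octTr], ?_⟩
      simp only [octN, Matrix.cons_val]
      linear_combination hz
    · rintro ⟨a, ht, hn⟩
      ext i
      fin_cases i <;> simp
      exact neg_eq_of_add_eq_zero_right ht
  rw [← Nat.card_coe_set_eq]
  refine h3.trans ?_
  simp only [h0, h1, h2, Nat.card_prod] at e1 e2 e3
  simp only [Nat.card_eq_fintype_card (α := F)] at e1 e2 e3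
  nlinarith

/-- Suppose `q > 2`.  The orbit of `x_1` under the group of
`F_q`-algebra automorphisms of `O` is exactly
`{α ∈ O : α ≠ 0, Tr(α) = 0, N(α) = 0}`, and this orbit has cardinality `q^6 − 1`. -/
theorem stmt_5 {F : Type*} [Field F] [Fintype F] (hq : 2 < Fintype.card F) :
    ({v : Fin 8 → F | ∃ g : (Fin 8 → F) ≃ₗ[F] (Fin 8 → F),
        (∀ x y, g (octMul x y) = octMul (g x) (g y)) ∧ g octX1 = v} =
      {α : Fin 8 → F | α ≠ 0 ∧ octTr α = 0 ∧ octN α = 0}) ∧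
    ({v : Fin 8 → F | ∃ g : (Fin 8 → F) ≃ₗ[F] (Fin 8 → F),
        (∀ x y, g (octMul x y) = octMul (g x) (g y)) ∧ g octX1 = v}.ncard =
      Fintype.card F ^ 6 - 1) := by
  change {v : Fin 8 → F | OctRel octX1 v} = _ ∧
    {v : Fin 8 → F | OctRel octX1 v}.ncard = _
  refine ⟨octOrbit_eq, ?_⟩
  have h : {a : Fin 8 → F | a ≠ 0 ∧ octTr a = 0 ∧ octN a = 0} =
      {a : Fin 8 → F | octTr a = 0 ∧ octN a = 0} \ {0} := by
    ext a
    simp [and_comm]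
  rw [octOrbit_eq, h, Set.ncard_sdiff_singleton_of_mem (by simp [octTr, octN]), card_octNull]
end
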